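/- arXiv:2106.04417 — 2 statements merged into one kernel-verified Lean document; each statement's English description precedes it below -/
import Mathlib

section
/- Let T and T' be finite trees, each having at least one vertex of degree at least 3. If their bivariate subtree polynomials are equal, i.e. S_T(q,r) = S_{T'}(q,r), then their trunks have the same number of vertices, i.e. |V(T°)| = |V(T'°)|. -/
open scoped Classical

noncomputable section

variable {V : Type*}

/-- A coloring `κ : V → ℕ` is proper if adjacent vertices get distinct colors. -/
def Proper (G : SimpleGraph V) (κ : V → ℕ) : Prop :=
  ∀ ⦃u v : V⦄, G.Adj u v → κ u ≠ κ v

/-- The chromatic symmetric function of `G`, as a formal power series in the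
variables `x_0, x_1, x_2, …`: the coefficient of the monomial `∏ i, x_i ^ m i`
is the number of proper colorings `κ : V → ℕ` using color `i` exactly `m i` times. -/
def csf [Fintype V] (G : SimpleGraph V) : MvPowerSeries ℕ ℤ :=
  fun m => (Nat.card {κ : V → ℕ // Proper G κ ∧ ∀ i : ℕ, Nat.card {v : V // κ v = i} = m i} : ℤ)

/-- `A` is (the vertex set of) a subtree of `T`: the induced subgraph on `A` is
connected and has at least one edge. -/
def IsSubtree [Fintype V] (T : SimpleGraph V) (A : Finset V) : Prop :=
  (T.induce (A : Set V)).Connected ∧ ∃ u ∈ A, ∃ v ∈ A, T.Adj u v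

/-- The number of edges of the subgraph of `T` induced on `A`. -/
def edgeCount [Fintype V] (T : SimpleGraph V) (A : Finset V) : ℕ :=
  Nat.card (T.induce (A : Set V)).edgeSet

/-- The number of leaves (vertices of degree 1) of the subgraph of `T` induced on `A`. -/
def leafCount [Fintype V] (T : SimpleGraph V) (A : Finset V) : ℕ :=
  Nat.card {v : (A : Set V) // Nat.card ((T.induce (A : Set V)).neighborSet v) = 1}

/-- The bivariate subtree polynomial `S_T(q, r) = ∑_{subtrees S of T} q^{|E(S)|} r^{|L(S)|}`,
with `q = X 0` and `r = X 1`. -/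
def subtreePoly [Fintype V] (T : SimpleGraph V) : MvPolynomial (Fin 2) ℤ :=
  ∑ A ∈ Finset.univ.powerset.filter (fun A => IsSubtree T A),
    MvPolynomial.X 0 ^ edgeCount T A * MvPolynomial.X 1 ^ leafCount T A

/-- The degree sequence of `T`, as a multiset. -/
def degreeSequence [Fintype V] (T : SimpleGraph V) : Multiset ℕ :=
  Finset.univ.val.map (fun v => T.degree v)

/-- The set of leaves (vertices of degree 1) of `T`. -/
def leaves [Fintype V] (T : SimpleGraph V) : Finset V :=
  Finset.univ.filter (fun v => T.degree v = 1)

/-- `A` is (the vertex set of) the trunk of `T`: the smallest connected induced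
subgraph of `T` containing every vertex of degree at least 3. -/
def IsTrunk [Fintype V] (T : SimpleGraph V) (A : Finset V) : Prop :=
  (T.induce (A : Set V)).Connected ∧ (∀ v : V, 3 ≤ T.degree v → v ∈ A) ∧
    ∀ B : Finset V, (T.induce (B : Set V)).Connected → (∀ v : V, 3 ≤ T.degree v → v ∈ B) →
      A ⊆ B

/-- Every interior (non-endpoint) vertex of the walk `P` has degree 2 in `T`. -/
def InteriorDeg2 [Fintype V] (T : SimpleGraph V) {a b : V} (P : T.Walk a b) : Prop :=
  ∀ v ∈ P.support, v ≠ a → v ≠ b → T.degree v = 2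

/-- `P` is the twig of `l`: the longest path in `T` containing `l` all of whose
interior vertices have degree 2 in `T`. -/
def IsTwig [Fintype V] (T : SimpleGraph V) (l : V) {a b : V} (P : T.Walk a b) : Prop :=
  P.IsPath ∧ l ∈ P.support ∧ InteriorDeg2 T P ∧
    ∀ ⦃a' b' : V⦄ (Q : T.Walk a' b'), Q.IsPath → l ∈ Q.support → InteriorDeg2 T Q →
      Q.length ≤ P.length

/-- The length (number of edges) of the twig of `l`: the maximal length of a path
in `T` containing `l` all of whose interior vertices have degree 2 in `T`. -/
def twigLen [Fintype V] (T : SimpleGraph V) (l : V) : ℕ :=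
  sSup {n : ℕ | ∃ (a b : V) (P : T.Walk a b),
    P.IsPath ∧ l ∈ P.support ∧ InteriorDeg2 T P ∧ P.length = n}

/-- The multiset of lengths of the twigs of `T` (one twig for each leaf). -/
def twigLengths [Fintype V] (T : SimpleGraph V) : Multiset ℕ :=
  (leaves T).val.map (twigLen T)

end

section InducedSubtrees

variable {V : Type*} {T : SimpleGraph V} {S : Finset V}

/-- The degree of `v` in the subgraph of `T` induced on `S` (for `v ∈ S`). -/
noncomputable def indDegree (T : SimpleGraph V) (S : Finset V) (v : V) : ℕ :=
  (S.filter (T.Adj v)).card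

lemma natCard_neighborSet_induce (T : SimpleGraph V) (S : Finset V) (v : (S : Set V)) :
    Nat.card ((T.induce (S : Set V)).neighborSet v) = indDegree T S v := by
  rw [indDegree, ← Nat.card_eq_finsetCard]
  exact Nat.card_congr
    ⟨fun w => ⟨w.1.1, Finset.mem_filter.2 ⟨w.1.2, w.2⟩⟩,
      fun w => ⟨⟨w.1, (Finset.mem_filter.1 w.2).1⟩, (Finset.mem_filter.1 w.2).2⟩,
      fun _ => rfl, fun _ => rfl⟩

lemma degree_induce_coe (T : SimpleGraph V) (S : Finset V) (v : (S : Set V)) :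
    (T.induce (S : Set V)).degree v = indDegree T S v := by
  rw [← natCard_neighborSet_induce, Nat.card_eq_fintype_card,
    SimpleGraph.card_neighborSet_eq_degree]

/-- Removing a vertex of degree at most one from a connected induced subgraph with another vertex
keeps it connected. -/
lemma connected_induce_erase {l : V} (hS : (T.induce (S : Set V)).Connected)
    (hl : indDegree T S l ≤ 1) (hne : (S.erase l).Nonempty) :
    (T.induce (S.erase l : Set V)).Connected := by
  have hp : ((T.induce (S : Set V)).induce {x | x.1 ≠ l}).Preconnected := by
    refine hS.preconnected.induce_of_degree_eq_one fun v hv => ?_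
    obtain rfl : v.1 = l := not_not.1 hv
    rw [← natCard_neighborSet_induce, Nat.card_eq_fintype_card,
      Fintype.card_le_one_iff_subsingleton] at hl
    exact Set.subsingleton_coe _ |>.1 hl
  obtain ⟨a, ha⟩ := hne
  have hc : ((T.induce (S : Set V)).induce {x | x.1 ≠ l}).Connected :=
    { preconnected := hp
      nonempty := ⟨⟨⟨a, (Finset.mem_erase.1 ha).2⟩, (Finset.mem_erase.1 ha).1⟩⟩ }
  refine hc.map ⟨fun x => ⟨x.1.1, Finset.mem_erase.2 ⟨x.2, x.1.2⟩⟩, fun h => h⟩ fun x => ?_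
  exact ⟨⟨⟨x.1, (Finset.mem_erase.1 x.2).2⟩, (Finset.mem_erase.1 x.2).1⟩, rfl⟩

variable [Fintype V]

lemma indDegree_le_degree (T : SimpleGraph V) (S : Finset V) (v : V) :
    indDegree T S v ≤ T.degree v := by
  rw [← T.card_neighborFinset_eq_degree]
  refine Finset.card_le_card fun w hw => ?_
  simpa using (Finset.mem_filter.1 hw).2

lemma indDegree_univ (T : SimpleGraph V) (v : V) :
    indDegree T Finset.univ v = T.degree v := by
  rw [← T.card_neighborFinset_eq_degree, indDegree]
  congr 1
  ext w
  simp

lemma leafCount_eq_card_filter (T : SimpleGraph V) (S : Finset V) :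
    leafCount T S = (S.filter fun v => indDegree T S v = 1).card := by
  rw [leafCount, ← Nat.card_eq_finsetCard]
  refine Nat.card_congr ⟨fun v => ⟨v.1.1, ?_⟩, fun v => ⟨⟨v.1, ?_⟩, ?_⟩, fun _ => rfl, fun _ => rfl⟩
  · exact Finset.mem_filter.2 ⟨v.1.2, (natCard_neighborSet_induce T S v.1).symm.trans v.2⟩
  · exact (Finset.mem_filter.1 v.2).1
  · exact (natCard_neighborSet_induce T S _).trans (Finset.mem_filter.1 v.2).2

lemma edgeCount_add_one (hT : T.IsAcyclic) (hS : (T.induce (S : Set V)).Connected) :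
    edgeCount T S + 1 = S.card := by
  have h := (SimpleGraph.IsTree.mk hS (hT.induce _)).card_edgeFinset
  rw [edgeCount, Nat.card_eq_fintype_card, ← SimpleGraph.edgeFinset_card, h]
  simp

lemma sum_indDegree_add_two (hT : T.IsAcyclic) (hS : (T.induce (S : Set V)).Connected) :
    ∑ v ∈ S, indDegree T S v + 2 = 2 * S.card := by
  have h := (T.induce (S : Set V)).sum_degrees_eq_twice_card_edges
  have h' := edgeCount_add_one hT hS
  rw [edgeCount, Nat.card_eq_fintype_card, ← SimpleGraph.edgeFinset_card] at h'
  simp only [degree_induce_coe] at h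
  rw [← Finset.sum_coe_sort]
  change ∑ v : S, indDegree T S v = _ at h
  omega

lemma IsSubtree.indDegree_pos (hS : IsSubtree T S) {v : V} (hv : v ∈ S) :
    0 < indDegree T S v := by
  obtain ⟨hc, a, ha, b, hb, hab⟩ := hS
  have : Nontrivial (S : Set V) :=
    ⟨⟨a, ha⟩, ⟨b, hb⟩, fun h => hab.ne (congrArg Subtype.val h)⟩
  simpa only [degree_induce_coe] using hc.preconnected.degree_pos_of_nontrivial ⟨v, hv⟩

lemma IsSubtree.leafCount_eq (hT : T.IsAcyclic) (hS : IsSubtree T S) :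
    leafCount T S = ∑ v ∈ S, (indDegree T S v - 2) + 2 := by
  have h := sum_indDegree_add_two hT hS.1
  have h' : ∑ v ∈ S, (indDegree T S v + if indDegree T S v = 1 then 1 else 0) =
      ∑ v ∈ S, (2 + (indDegree T S v - 2)) := by
    refine Finset.sum_congr rfl fun v hv => ?_
    have := hS.indDegree_pos hv
    split_ifs <;> omega
  rw [Finset.sum_add_distrib, Finset.sum_add_distrib, Finset.sum_const, smul_eq_mul,
    ← Finset.card_filter, ← leafCount_eq_card_filter] at h'
  omega

/-- The vertices of `A` together with all their neighbors. -/
noncomputable def closedNbhd (T : SimpleGraph V) (A : Finset V) : Finset V :=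
  A ∪ A.biUnion fun v => T.neighborFinset v

lemma connected_induce_closedNbhd {A : Finset V} (hA : (T.induce (A : Set V)).Connected) :
    (T.induce (closedNbhd T A : Set V)).Connected := by
  have hsub : (A : Set V) ⊆ closedNbhd T A := Finset.coe_subset.2 Finset.subset_union_left
  obtain ⟨⟨a, ha⟩⟩ := hA.nonempty
  have hreach (v : V) (hv : v ∈ A) :
      (T.induce (closedNbhd T A : Set V)).Reachable ⟨a, hsub ha⟩ ⟨v, hsub hv⟩ :=
    (hA.preconnected ⟨a, ha⟩ ⟨v, hv⟩).map (SimpleGraph.induceHomOfLE T hsub).toHom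
  refine (SimpleGraph.connected_iff_exists_forall_reachable _).2 ⟨⟨a, hsub ha⟩, fun ⟨w, hw⟩ => ?_⟩
  rcases Finset.mem_union.1 (Finset.mem_coe.1 hw) with hwA | hwN
  · exact hreach w hwA
  · obtain ⟨v, hv, hvw⟩ := Finset.mem_biUnion.1 hwN
    refine (hreach v hv).trans (SimpleGraph.Adj.reachable ?_)
    simpa using hvw

lemma indDegree_closedNbhd {A : Finset V} {v : V} (hv : v ∈ A) :
    indDegree T (closedNbhd T A) v = T.degree v := by
  rw [← T.card_neighborFinset_eq_degree, indDegree]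
  congr 1
  ext w
  simp only [Finset.mem_filter, SimpleGraph.mem_neighborFinset, and_iff_right_iff_imp]
  exact fun h => Finset.mem_union_right _ (Finset.mem_biUnion.2 ⟨v, hv, by simpa using h⟩)

lemma card_closedNbhd_add_sum_le (T : SimpleGraph V) (A : Finset V) :
    (closedNbhd T A).card + ∑ v ∈ A, indDegree T A v ≤ A.card + ∑ v ∈ A, T.degree v := by
  have hsub : closedNbhd T A ⊆ A ∪ A.biUnion fun v => T.neighborFinset v \ A := by
    intro w hw
    simp only [closedNbhd, Finset.mem_union, Finset.mem_biUnion, Finset.mem_sdiff] at hw ⊢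
    tauto
  have hle : (closedNbhd T A).card ≤ A.card + ∑ v ∈ A, (T.neighborFinset v \ A).card :=
    (Finset.card_le_card hsub).trans <| (Finset.card_union_le _ _).trans <|
      Nat.add_le_add_left Finset.card_biUnion_le _
  have hdeg (v : V) : (T.neighborFinset v \ A).card + indDegree T A v = T.degree v := by
    rw [← T.card_neighborFinset_eq_degree, ← Finset.card_sdiff_add_card_inter (T.neighborFinset v) A,
      indDegree]
    refine congrArg (fun B : Finset V => (T.neighborFinset v \ A).card + B.card) ?_
    ext w
    simp [and_comm]
  have hsum := Finset.sum_congr rfl fun v (_ : v ∈ A) => hdeg v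
  rw [Finset.sum_add_distrib] at hsum
  omega

lemma isSubtree_univ (hT : T.Connected) (hdeg : ∃ v, 3 ≤ T.degree v) :
    IsSubtree T Finset.univ := by
  obtain ⟨v, hv⟩ := hdeg
  obtain ⟨w, hw⟩ := (T.degree_pos_iff_exists_adj v).1 (by omega)
  refine ⟨?_, v, Finset.mem_univ _, w, Finset.mem_univ _, hw⟩
  rw [Finset.coe_univ]
  exact (SimpleGraph.induceUnivIso T).connected_iff.2 hT

lemma sum_indDegree_sub_two_le (T : SimpleGraph V) (S : Finset V) :
    ∑ v ∈ S, (indDegree T S v - 2) ≤ ∑ v, (T.degree v - 2) :=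
  (Finset.sum_le_sum fun v _ => Nat.sub_le_sub_right (indDegree_le_degree T S v) 2).trans
    (Finset.sum_le_sum_of_subset (Finset.subset_univ S))

lemma leafCount_univ (hT : T.IsTree) (hdeg : ∃ v, 3 ≤ T.degree v) :
    leafCount T Finset.univ = ∑ v, (T.degree v - 2) + 2 := by
  simpa only [indDegree_univ] using (isSubtree_univ hT.connected hdeg).leafCount_eq hT.isAcyclic

lemma IsSubtree.leafCount_le (hT : T.IsTree) (hdeg : ∃ v, 3 ≤ T.degree v) (hS : IsSubtree T S) :
    leafCount T S ≤ leafCount T Finset.univ := by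
  rw [leafCount_univ hT hdeg, hS.leafCount_eq hT.isAcyclic]
  exact Nat.add_le_add_right (sum_indDegree_sub_two_le T S) 2

/-- A subtree with as many leaves as the whole tree contains every branching vertex, with all
its neighbors. -/
lemma IsSubtree.mem_and_indDegree_eq (hT : T.IsTree) (hS : IsSubtree T S)
    (hleaf : leafCount T S = leafCount T Finset.univ) {v : V} (hv : 3 ≤ T.degree v) :
    v ∈ S ∧ indDegree T S v = T.degree v := by
  rw [leafCount_univ hT ⟨v, hv⟩, hS.leafCount_eq hT.isAcyclic, Nat.add_right_cancel_iff,
    ← Fintype.sum_ite_mem] at hleaf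
  have hle (w : V) : (if w ∈ S then indDegree T S w - 2 else 0) ≤ T.degree w - 2 := by
    have := indDegree_le_degree T S w
    split_ifs <;> omega
  have heq := (Finset.sum_eq_sum_iff_of_le fun w _ => hle w).1 hleaf v (Finset.mem_univ v)
  have := indDegree_le_degree T S v
  split_ifs at heq with hvS
  · exact ⟨hvS, by omega⟩
  · omega

/-- A subtree with as many leaves as the whole tree contains the trunk, none of its leaves being
in the trunk. -/
lemma IsTrunk.card_add_leafCount_le {A : Finset V} (hA : IsTrunk T A) (hT : T.IsTree)
    (hdeg : ∃ v, 3 ≤ T.degree v) (hS : IsSubtree T S)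
    (hleaf : leafCount T S = leafCount T Finset.univ) :
    A.card + leafCount T S ≤ S.card := by
  have hbr (v : V) (hv : 3 ≤ T.degree v) := hS.mem_and_indDegree_eq hT hleaf hv
  have hdisj : Disjoint A (S.filter fun v => indDegree T S v = 1) := by
    refine Finset.disjoint_left.2 fun l hlA hl => ?_
    have hl1 := (Finset.mem_filter.1 hl).2
    have hmem (v : V) (hv : 3 ≤ T.degree v) : v ∈ S.erase l := by
      refine Finset.mem_erase.2 ⟨?_, (hbr v hv).1⟩
      rintro rfl
      have := (hbr v hv).2
      omega
    obtain ⟨v, hv⟩ := hdeg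
    exact Finset.notMem_erase l S
      (hA.2.2 _ (connected_induce_erase hS.1 hl1.le ⟨v, hmem v hv⟩) hmem hlA)
  rw [leafCount_eq_card_filter, ← Finset.card_union_of_disjoint hdisj]
  exact Finset.card_le_card
    (Finset.union_subset (hA.2.2 S hS.1 fun v hv => (hbr v hv).1) (Finset.filter_subset _ _))

/-- The trunk together with its neighbors is a subtree with as many leaves as the whole tree, and
every vertex outside the trunk accounts for one of these leaves. -/
lemma IsTrunk.exists_isSubtree {A : Finset V} (hA : IsTrunk T A) (hT : T.IsTree)
    (hdeg : ∃ v, 3 ≤ T.degree v) :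
    ∃ S, IsSubtree T S ∧ leafCount T S = leafCount T Finset.univ ∧
      S.card = A.card + leafCount T S := by
  have hS : IsSubtree T (closedNbhd T A) := by
    obtain ⟨v, hv⟩ := hdeg
    obtain ⟨w, hw⟩ := (T.degree_pos_iff_exists_adj v).1 (by omega)
    exact ⟨connected_induce_closedNbhd hA.1, v, Finset.mem_union_left _ (hA.2.1 v hv), w,
      Finset.mem_union_right _ (Finset.mem_biUnion.2 ⟨v, hA.2.1 v hv, by simpa using hw⟩), hw⟩
  have hsum : ∑ v, (T.degree v - 2) = ∑ v ∈ A, (T.degree v - 2) := by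
    refine (Finset.sum_subset (Finset.subset_univ A) fun v _ hv => ?_).symm
    have := mt (hA.2.1 v) hv
    omega
  have hle : ∑ v ∈ A, (T.degree v - 2) ≤
      ∑ v ∈ closedNbhd T A, (indDegree T (closedNbhd T A) v - 2) := by
    refine (Finset.sum_le_sum fun v hv => ?_).trans
      (Finset.sum_le_sum_of_subset Finset.subset_union_left)
    rw [indDegree_closedNbhd hv]
  have hleaf : leafCount T (closedNbhd T A) = leafCount T Finset.univ := by
    refine (hS.leafCount_le hT hdeg).antisymm ?_
    rw [leafCount_univ hT hdeg, hS.leafCount_eq hT.isAcyclic]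
    omega
  refine ⟨_, hS, hleaf, le_antisymm ?_ (hA.card_add_leafCount_le hT hdeg hS hleaf)⟩
  have hcard := card_closedNbhd_add_sum_le T A
  have hAsum := sum_indDegree_add_two hT.isAcyclic hA.1
  have hbound : ∑ v ∈ A, T.degree v ≤ ∑ v ∈ A, ((T.degree v - 2) + 2) :=
    Finset.sum_le_sum fun v _ => by omega
  rw [Finset.sum_add_distrib, Finset.sum_const, smul_eq_mul] at hbound
  rw [hleaf, leafCount_univ hT hdeg]
  omega

lemma coeff_subtreePoly (T : SimpleGraph V) (e l : ℕ) :
    (subtreePoly T).coeff (Finsupp.single 0 e + Finsupp.single 1 l) =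
      (Finset.univ.filter fun A : Finset V =>
        IsSubtree T A ∧ edgeCount T A = e ∧ leafCount T A = l).card := by
  have hmon (a b : ℕ) : (MvPolynomial.X 0 ^ a * MvPolynomial.X 1 ^ b : MvPolynomial (Fin 2) ℤ) =
      MvPolynomial.monomial (Finsupp.single 0 a + Finsupp.single 1 b) 1 := by
    simp [MvPolynomial.X_pow_eq_monomial, MvPolynomial.monomial_mul]
  have hiff (a b : ℕ) : (Finsupp.single 0 a + Finsupp.single 1 b : Fin 2 →₀ ℕ) =
      Finsupp.single 0 e + Finsupp.single 1 l ↔ a = e ∧ b = l := by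
    refine ⟨fun h => ⟨?_, ?_⟩, by rintro ⟨rfl, rfl⟩; rfl⟩
    · simpa using DFunLike.congr_fun h 0
    · simpa using DFunLike.congr_fun h 1
  simp only [subtreePoly, MvPolynomial.coeff_sum, hmon, MvPolynomial.coeff_monomial, hiff,
    Finset.powerset_univ]
  rw [Finset.sum_boole, Finset.filter_filter]

end InducedSubtrees

lemma IsSubtree.exists_of_subtreePoly_eq {V V' : Type*} [Fintype V] [Fintype V']
    {T : SimpleGraph V} {T' : SimpleGraph V'} (h : subtreePoly T = subtreePoly T')
    {S : Finset V} (hS : IsSubtree T S) :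
    ∃ S', IsSubtree T' S' ∧ edgeCount T' S' = edgeCount T S ∧ leafCount T' S' = leafCount T S := by
  have hcoeff := congrArg
    (MvPolynomial.coeff (Finsupp.single 0 (edgeCount T S) + Finsupp.single 1 (leafCount T S))) h
  rw [coeff_subtreePoly, coeff_subtreePoly, Nat.cast_inj] at hcoeff
  have hpos : 0 < (Finset.univ.filter fun B : Finset V =>
      IsSubtree T B ∧ edgeCount T B = edgeCount T S ∧ leafCount T B = leafCount T S).card :=
    Finset.card_pos.2 ⟨S, Finset.mem_filter.2 ⟨Finset.mem_univ S, hS, rfl, rfl⟩⟩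
  rw [hcoeff] at hpos
  obtain ⟨S', hS'⟩ := Finset.card_pos.1 hpos
  exact ⟨S', (Finset.mem_filter.1 hS').2⟩

lemma leafCount_univ_le_of_subtreePoly_eq {V V' : Type*} [Fintype V] [Fintype V']
    {T : SimpleGraph V} {T' : SimpleGraph V'} (hT : T.IsTree) (hT' : T'.IsTree)
    (hdeg : ∃ v : V, 3 ≤ T.degree v) (hdeg' : ∃ v : V', 3 ≤ T'.degree v)
    (h : subtreePoly T = subtreePoly T') :
    leafCount T Finset.univ ≤ leafCount T' Finset.univ := by
  obtain ⟨S', hS', -, hl⟩ := (isSubtree_univ hT.connected hdeg).exists_of_subtreePoly_eq h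
  exact hl ▸ hS'.leafCount_le hT' hdeg'

lemma IsTrunk.card_le_of_subtreePoly_eq {V V' : Type*} [Fintype V] [Fintype V']
    {T : SimpleGraph V} {T' : SimpleGraph V'} (hT : T.IsTree) (hT' : T'.IsTree)
    (hdeg : ∃ v : V, 3 ≤ T.degree v) (hdeg' : ∃ v : V', 3 ≤ T'.degree v)
    {A : Finset V} {A' : Finset V'} (hA : IsTrunk T A) (hA' : IsTrunk T' A')
    (h : subtreePoly T = subtreePoly T') :
    A'.card ≤ A.card := by
  have hleaf := (leafCount_univ_le_of_subtreePoly_eq hT hT' hdeg hdeg' h).antisymm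
    (leafCount_univ_le_of_subtreePoly_eq hT' hT hdeg' hdeg h.symm)
  obtain ⟨S, hS, hSl, hScard⟩ := hA.exists_isSubtree hT hdeg
  obtain ⟨S', hS', he, hl⟩ := hS.exists_of_subtreePoly_eq h
  have hle := hA'.card_add_leafCount_le hT' hdeg' hS' (hl.trans (hSl.trans hleaf))
  have hcard := edgeCount_add_one hT.isAcyclic hS.1
  have hcard' := edgeCount_add_one hT'.isAcyclic hS'.1
  omega

theorem stmt2 {V V' : Type*} [Fintype V] [Fintype V']
    (T : SimpleGraph V) (T' : SimpleGraph V') (hT : T.IsTree) (hT' : T'.IsTree)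
    (hdeg : ∃ v : V, 3 ≤ T.degree v) (hdeg' : ∃ v : V', 3 ≤ T'.degree v)
    (A : Finset V) (A' : Finset V') (hA : IsTrunk T A) (hA' : IsTrunk T' A')
    (h : subtreePoly T = subtreePoly T') :
    A.card = A'.card := by
  exact (hA'.card_le_of_subtreePoly_eq hT' hT hdeg' hdeg hA h.symm).antisymm
    (hA.card_le_of_subtreePoly_eq hT hT' hdeg hdeg' hA' h)
end

section
/- Let T and T' be finite trees, each having at least one vertex of degree at least 3. If the chromatic symmetric functions of T and T' are equal, i.e. X_T = X_{T'}, then the trunks of T and T' have the same number of vertices, and the multiset of lengths (numbers of edges) of the twigs of T equals the multiset of lengths of the twigs of T'. -/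
open scoped Classical

/-- `p` is the parent map and `h` the depth function of the tree `T` rooted at `r`. -/
structure IsRooting {V : Type*} (T : SimpleGraph V) (r : V) (p : V → V) (h : V → ℕ) : Prop where
  parent_root : p r = r
  depth_parent : ∀ x, x ≠ r → h (p x) + 1 = h x
  adj_iff : ∀ x y, T.Adj x y ↔ (x ≠ r ∧ p x = y) ∨ (y ≠ r ∧ p y = x)

theorem SimpleGraph.Connected.exists_adj_dist_succ {V : Type*} {T : SimpleGraph V}
    (hT : T.Connected) {x r : V} (hx : x ≠ r) :
    ∃ y, T.Adj x y ∧ T.dist y r + 1 = T.dist x r := by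
  obtain ⟨w, hw⟩ := hT.exists_walk_length_eq_dist x r
  cases w with
  | nil => exact absurd rfl hx
  | @cons _ y _ hadj w =>
    refine ⟨y, hadj, ?_⟩
    have h1 : T.dist y r ≤ w.length := SimpleGraph.dist_le w
    obtain ⟨w', hw'⟩ := hT.exists_walk_length_eq_dist y r
    have h2 : T.dist x r ≤ (SimpleGraph.Walk.cons hadj w').length := SimpleGraph.dist_le _
    simp only [SimpleGraph.Walk.length_cons] at hw h2
    omega

theorem exists_isRooting {V : Type*} [Fintype V] {T : SimpleGraph V} (hT : T.IsTree) (r : V) :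
    ∃ p h, IsRooting T r p h := by
  have hex : ∀ x, ∃ y, (x = r → y = r) ∧ (x ≠ r → T.Adj x y ∧ T.dist y r + 1 = T.dist x r) := by
    intro x
    by_cases hx : x = r
    · exact ⟨r, fun _ => rfl, fun h => absurd hx h⟩
    · obtain ⟨y, hy⟩ := hT.connected.exists_adj_dist_succ hx
      exact ⟨y, fun h => absurd h hx, fun _ => hy⟩
  choose p hp₀ hp₁ using hex
  have hinj : Set.InjOn (fun x => s(x, p x)) ((Finset.univ.erase r : Finset V) : Set V) := by
    intro x hx y hy hxy
    simp only [Finset.coe_erase, Finset.coe_univ, Set.mem_sdiff, Set.mem_univ,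
      Set.mem_singleton_iff, true_and] at hx hy
    rcases Sym2.eq_iff.1 hxy with h | ⟨h₁, h₂⟩
    · exact h.1
    · have e₁ := (hp₁ x hx).2
      have e₂ := (hp₁ y hy).2
      rw [h₂] at e₁
      rw [← h₁] at e₂
      omega
  have hsub : (Finset.univ.erase r).image (fun x => s(x, p x)) ⊆ T.edgeFinset := by
    intro e he
    obtain ⟨x, hx, rfl⟩ := Finset.mem_image.1 he
    rw [SimpleGraph.mem_edgeFinset, SimpleGraph.mem_edgeSet]
    exact (hp₁ x (Finset.ne_of_mem_erase hx)).1
  have himg : (Finset.univ.erase r).image (fun x => s(x, p x)) = T.edgeFinset := by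
    refine Finset.eq_of_subset_of_card_le hsub ?_
    have h₁ := hT.card_edgeFinset
    rw [Finset.card_image_of_injOn hinj, Finset.card_erase_of_mem (Finset.mem_univ r),
      Finset.card_univ]
    omega
  refine ⟨p, fun x => T.dist x r, hp₀ r rfl, fun x hx => (hp₁ x hx).2,
    fun x y => ⟨fun hxy => ?_, ?_⟩⟩
  · have hmem : s(x, y) ∈ (Finset.univ.erase r).image (fun x => s(x, p x)) := by
      rw [himg, SimpleGraph.mem_edgeFinset]
      exact hxy
    obtain ⟨z, hz, hzxy⟩ := Finset.mem_image.1 hmem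
    have hz' := Finset.ne_of_mem_erase hz
    rcases Sym2.eq_iff.1 hzxy with ⟨rfl, rfl⟩ | ⟨rfl, rfl⟩
    · exact Or.inl ⟨hz', rfl⟩
    · exact Or.inr ⟨hz', rfl⟩
  · rintro (⟨hx, rfl⟩ | ⟨hy, rfl⟩)
    · exact (hp₁ x hx).1
    · exact (hp₁ y hy).1.symm

namespace IsRooting

variable {V : Type*} {T : SimpleGraph V} {r : V} {p : V → V} {h : V → ℕ}

theorem adj_parent (R : IsRooting T r p h) {x : V} (hx : x ≠ r) : T.Adj x (p x) :=
  (R.adj_iff _ _).2 (Or.inl ⟨hx, rfl⟩)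

theorem iterate_root (R : IsRooting T r p h) (i : ℕ) : p^[i] r = r :=
  Function.iterate_fixed R.parent_root i

theorem exists_iterate_eq_root (R : IsRooting T r p h) (x : V) : ∃ i, p^[i] x = r := by
  induction hn : h x using Nat.strong_induction_on generalizing x with
  | _ n ih =>
    by_cases hx : x = r
    · exact ⟨0, hx⟩
    · have hd := R.depth_parent x hx
      obtain ⟨i, hi⟩ := ih (h (p x)) (by omega) (p x) rfl
      exact ⟨i + 1, hi⟩

theorem degree_eq [Fintype V] (R : IsRooting T r p h) (v : V) :
    T.degree v = (Finset.univ.filter fun x => x ≠ r ∧ p x = v).card + if v = r then 0 else 1 := by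
  have hN : T.neighborFinset v = (Finset.univ.filter fun x => x ≠ r ∧ p x = v) ∪
      if v = r then ∅ else {p v} := by
    ext y
    rw [SimpleGraph.mem_neighborFinset, R.adj_iff]
    split_ifs with hv
    · simp [hv]
    · simp only [Finset.mem_union, Finset.mem_filter, Finset.mem_univ, true_and,
        Finset.mem_singleton, hv, ne_eq, not_false_eq_true]
      tauto
  rw [← SimpleGraph.card_neighborFinset_eq_degree, hN, Finset.card_union_of_disjoint]
  · split_ifs <;> simp
  · split_ifs with hv
    · simp
    · rw [Finset.disjoint_singleton_right, Finset.mem_filter]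
      rintro ⟨-, hpr, hpp⟩
      have h₁ := R.depth_parent v hv
      have h₂ := R.depth_parent _ hpr
      rw [hpp] at h₂
      omega

theorem connected_induce (R : IsRooting T r p h) {W : Set V} (hr : r ∈ W)
    (hW : ∀ x ∈ W, p x ∈ W) : (T.induce W).Connected := by
  have hreach : ∀ x : W, (T.induce W).Reachable x ⟨r, hr⟩ := by
    rintro ⟨x, hx⟩
    induction hn : h x using Nat.strong_induction_on generalizing x with
    | _ n ih =>
      by_cases hxr : x = r
      · subst hxr
        exact SimpleGraph.Reachable.refl _
      · have hd := R.depth_parent x hxr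
        have hadj : (T.induce W).Adj ⟨x, hx⟩ ⟨p x, hW x hx⟩ := R.adj_parent hxr
        exact hadj.reachable.trans (ih (h (p x)) (by omega) (p x) (hW x hx) rfl)
  have : Nonempty W := ⟨⟨r, hr⟩⟩
  exact ⟨fun x y => (hreach x).trans (hreach y).symm⟩

theorem parent_mem_of_connected (R : IsRooting T r p h) {W : Set V} (hr : r ∈ W)
    (hW : (T.induce W).Connected) {x : V} (hx : x ∈ W) : p x ∈ W := by
  by_cases hxr : x = r
  · rwa [hxr, R.parent_root]
  obtain ⟨w⟩ := hW.preconnected ⟨x, hx⟩ ⟨r, hr⟩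
  obtain ⟨d, -, ⟨i, hi⟩, hd₂⟩ := w.exists_boundary_dart {y : W | ∃ i, p^[i] (y : V) = x} ⟨0, rfl⟩
    (by rintro ⟨i, hi⟩; rw [R.iterate_root] at hi; exact hxr hi.symm)
  rcases (R.adj_iff _ _).1 d.adj with ⟨-, he⟩ | ⟨-, he⟩
  · have he' : p (d.fst : V) = (d.snd : V) := he
    cases i with
    | zero =>
      have hi' : (d.fst : V) = x := hi
      rw [← hi', he']
      exact d.snd.2
    | succ i =>
      refine absurd ⟨i, ?_⟩ hd₂
      rw [← he']
      exact hi
  · refine absurd ⟨i + 1, ?_⟩ hd₂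
    have he' : p (d.snd : V) = (d.fst : V) := he
    rw [Function.iterate_succ_apply, he']
    exact hi

theorem exists_path_iterate (R : IsRooting T r p h) (i : ℕ) (x : V)
    (hx : ∀ k < i, p^[k] x ≠ r) :
    ∃ P : T.Walk x (p^[i] x), P.IsPath ∧ P.length = i ∧
      ∀ v ∈ P.support, h v ≤ h x ∧ ∃ k ≤ i, v = p^[k] x := by
  induction i generalizing x with
  | zero => exact ⟨SimpleGraph.Walk.nil, by simp, rfl, by simp⟩
  | succ i ih =>
    have hxr : x ≠ r := hx 0 (by omega)
    obtain ⟨P, hP, hlen, hs⟩ := ih (p x) (fun k hk => hx (k + 1) (by omega))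
    have hd := R.depth_parent x hxr
    rw [Function.iterate_succ_apply]
    refine ⟨SimpleGraph.Walk.cons (R.adj_parent hxr) P, ?_, ?_, ?_⟩
    · rw [SimpleGraph.Walk.cons_isPath_iff]
      refine ⟨hP, fun hmem => ?_⟩
      have := (hs x hmem).1
      omega
    · simp [hlen]
    · intro v hv
      rw [SimpleGraph.Walk.support_cons, List.mem_cons] at hv
      rcases hv with rfl | hv
      · exact ⟨le_rfl, 0, by omega, rfl⟩
      · obtain ⟨h₁, k, hk, rfl⟩ := hs v hv
        exact ⟨by omega, k + 1, by omega, rfl⟩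

end IsRooting

/-- The number of parent steps from `l` to the nearest vertex of degree at least `3`. -/
noncomputable def chainLength {V : Type*} [Fintype V] (T : SimpleGraph V) (p : V → V) (l : V) : ℕ :=
  sInf {i | 3 ≤ T.degree (p^[i] l)}

theorem degree_iterate_le_two {V : Type*} [Fintype V] {T : SimpleGraph V} {p : V → V} {l : V}
    {i : ℕ} (hi : i < chainLength T p l) : T.degree (p^[i] l) ≤ 2 := by
  have : ¬ 3 ≤ T.degree (p^[i] l) := 
    Nat.notMem_of_lt_sInf (s := {i | 3 ≤ T.degree (p^[i] l)}) hi
  omega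

theorem iterate_mem_of_le {V : Type*} {p : V → V} {W : Set V} (hp : ∀ x ∈ W, p x ∈ W) {x : V}
    {i k : ℕ} (hik : i ≤ k) (hi : p^[i] x ∈ W) : p^[k] x ∈ W := by
  induction k, hik using Nat.le_induction with
  | base => exact hi
  | succ k _ ih => rw [Function.iterate_succ_apply']; exact hp _ ih

namespace IsRooting

variable {V : Type*} [Fintype V] {T : SimpleGraph V} {r : V} {p : V → V} {h : V → ℕ}

theorem three_le_degree_iterate (R : IsRooting T r p h) (hr : 3 ≤ T.degree r) (l : V) :
    3 ≤ T.degree (p^[chainLength T p l] l) := by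
  obtain ⟨i, hi⟩ := R.exists_iterate_eq_root l
  exact Nat.sInf_mem (s := {i | 3 ≤ T.degree (p^[i] l)}) 
    ⟨i, by rw [Set.mem_ofPred_eq, hi]; exact hr⟩

theorem iterate_ne_root (hr : 3 ≤ T.degree r) {l : V} {i : ℕ}
    (hi : i < chainLength T p l) : p^[i] l ≠ r := by
  intro he
  have := degree_iterate_le_two hi
  rw [he] at this
  omega

theorem degree_pos (R : IsRooting T r p h) (hr : 3 ≤ T.degree r) (v : V) : 1 ≤ T.degree v := by
  by_cases hv : v = r
  · subst hv; omega
  · rw [R.degree_eq, if_neg hv]; omega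

theorem ne_root_of_leaf (hr : 3 ≤ T.degree r) {l : V} (hl : T.degree l = 1) : l ≠ r := by
  rintro rfl
  omega

theorem parent_ne_leaf (R : IsRooting T r p h) (hr : 3 ≤ T.degree r) {l x : V}
    (hl : T.degree l = 1) (hx : x ≠ r) : p x ≠ l := by
  intro he
  have hd := R.degree_eq l
  rw [hl, if_neg (ne_root_of_leaf hr hl)] at hd
  have h0 := Finset.card_eq_zero.1 (show (Finset.univ.filter fun x => x ≠ r ∧ p x = l).card = 0 by
    omega)
  have : x ∈ Finset.univ.filter fun x => x ≠ r ∧ p x = l := by simp [hx, he]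
  simp [h0] at this

theorem child_unique (R : IsRooting T r p h) {v x y : V} (hv : v ≠ r)
    (hd : T.degree v ≤ 2) (hx : x ≠ r) (hy : y ≠ r) (hpx : p x = v) (hpy : p y = v) : x = y := by
  rw [R.degree_eq, if_neg hv] at hd
  exact Finset.card_le_one.1 (show (Finset.univ.filter fun x => x ≠ r ∧ p x = v).card ≤ 1 by omega)
    x (by simp [hx, hpx]) y (by simp [hy, hpy])

theorem chainLength_pos (R : IsRooting T r p h) (hr : 3 ≤ T.degree r) {l : V}
    (hl : T.degree l = 1) : 0 < chainLength T p l := by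
  by_contra hc
  have h₁ := R.three_le_degree_iterate hr l
  rw [show chainLength T p l = 0 by omega, Function.iterate_zero_apply] at h₁
  omega

theorem chain_injective (R : IsRooting T r p h) (hr : 3 ≤ T.degree r) {l l' : V}
    (hl : T.degree l = 1) (hl' : T.degree l' = 1) {i j : ℕ} (hi : i < chainLength T p l)
    (hj : j < chainLength T p l') (he : p^[i] l = p^[j] l') : i = j ∧ l = l' := by
  induction i generalizing j with
  | zero =>
    cases j with
    | zero => exact ⟨rfl, he⟩
    | succ j =>
      rw [Function.iterate_succ_apply', Function.iterate_zero_apply] at he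
      exact absurd he.symm (R.parent_ne_leaf hr hl (iterate_ne_root hr (by omega)))
  | succ i ih =>
    cases j with
    | zero =>
      rw [Function.iterate_succ_apply', Function.iterate_zero_apply] at he
      exact absurd he (R.parent_ne_leaf hr hl' (iterate_ne_root hr (by omega)))
    | succ j =>
      rw [Function.iterate_succ_apply', Function.iterate_succ_apply'] at he
      have hne := iterate_ne_root hr hi
      have hd := degree_iterate_le_two hi
      rw [Function.iterate_succ_apply'] at hne hd
      have := R.child_unique hne hd (iterate_ne_root hr (by omega))
        (iterate_ne_root hr (by omega)) rfl he.symm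
      obtain ⟨h₁, h₂⟩ := ih (by omega) (by omega) this
      exact ⟨by omega, h₂⟩

theorem exists_leaf (R : IsRooting T r p h) (hr : 3 ≤ T.degree r) (x : V) :
    ∃ l, T.degree l = 1 ∧ ∃ i, p^[i] l = x := by
  obtain ⟨y, hy, hmax⟩ := Finset.exists_max_image (Finset.univ.filter fun y => ∃ i, p^[i] y = x) h
    ⟨x, by simpa using ⟨0, rfl⟩⟩
  obtain ⟨i, hi⟩ := (Finset.mem_filter.1 hy).2
  have h0 : (Finset.univ.filter fun z => z ≠ r ∧ p z = y) = ∅ := by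
    rw [Finset.filter_eq_empty_iff]
    rintro z - ⟨hz, rfl⟩
    have h₁ := hmax z (by simpa using ⟨i + 1, hi⟩)
    have h₂ := R.depth_parent z hz
    omega
  have hd := R.degree_eq y
  rw [h0, Finset.card_empty] at hd
  have := R.degree_pos hr y
  exact ⟨y, by split_ifs at hd <;> omega, i, hi⟩

theorem exists_chain_of_notMem (R : IsRooting T r p h) (hr : 3 ≤ T.degree r) {W : Set V}
    (hp : ∀ x ∈ W, p x ∈ W) (hW : ∀ v, 3 ≤ T.degree v → v ∈ W) {x : V} (hx : x ∉ W) :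
    ∃ l, T.degree l = 1 ∧ ∃ i < chainLength T p l, p^[i] l = x := by
  obtain ⟨l, hl, i, rfl⟩ := R.exists_leaf hr x
  refine ⟨l, hl, i, ?_, rfl⟩
  by_contra hc
  have hle : chainLength T p l ≤ i := by omega
  exact hx (iterate_mem_of_le hp hle (hW _ (R.three_le_degree_iterate hr l)))

theorem length_le_chainLength (R : IsRooting T r p h) (hr : 3 ≤ T.degree r) {l b : V}
    (hl : T.degree l = 1) (Q : T.Walk l b) (hQ : Q.IsPath) (hQ2 : InteriorDeg2 T Q) :
    Q.length ≤ chainLength T p l := by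
  by_contra! hlt
  have hget : ∀ i ≤ chainLength T p l, Q.getVert i = p^[i] l := by
    intro i
    induction i using Nat.strong_induction_on with
    | _ i ih =>
      intro hi
      cases i with
      | zero => simp
      | succ i =>
        have hadj := Q.adj_getVert_succ (i := i) (by omega)
        have hne := iterate_ne_root hr (show i < chainLength T p l by omega)
        have hd := degree_iterate_le_two (show i < chainLength T p l by omega)
        rw [R.adj_iff, ih i (by omega) (by omega)] at hadj
        rcases hadj with ⟨-, he⟩ | ⟨hq, he⟩
        · rw [Function.iterate_succ_apply', he]
        · cases i with
          | zero => exact absurd he (R.parent_ne_leaf hr hl hq)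
          | succ i =>
            have := R.child_unique hne hd hq (iterate_ne_root hr (show i < _ by omega)) he
              (Function.iterate_succ_apply' p i l).symm
            have := hQ.getVert_injOn (show i + 1 + 1 ≤ Q.length by omega)
              (show i ≤ Q.length by omega) (by rw [this, ih i (by omega) (by omega)])
            omega
  have hpos := R.chainLength_pos hr hl
  have hc := hget _ le_rfl
  have h3 := R.three_le_degree_iterate hr l
  rw [← hc] at h3
  have := hQ2 (Q.getVert (chainLength T p l)) (Q.getVert_mem_support _)
    (fun he => by rw [he] at h3; omega)
    (fun he => by
      have := hQ.getVert_injOn (show chainLength T p l ≤ Q.length by omega)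
        (show Q.length ≤ Q.length by omega) (by rw [he, Q.getVert_length])
      omega)
  omega

theorem twigLen_eq (R : IsRooting T r p h) (hr : 3 ≤ T.degree r) {l : V}
    (hl : T.degree l = 1) : twigLen T l = chainLength T p l := by
  refine IsGreatest.csSup_eq ⟨?_, ?_⟩
  · obtain ⟨P, hP, hlen, hs⟩ := R.exists_path_iterate (chainLength T p l) l
      (fun k hk => iterate_ne_root hr hk)
    refine ⟨_, _, P, hP, P.start_mem_support, fun v hv hvl hve => ?_, hlen⟩
    obtain ⟨-, k, hk, rfl⟩ := hs v hv
    have hk' : k < chainLength T p l := lt_of_le_of_ne hk (by rintro rfl; exact hve rfl)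
    have h₁ := degree_iterate_le_two hk'
    have h₂ := R.degree_pos hr (p^[k] l)
    have h₃ : T.degree (p^[k] l) ≠ 1 := by
      intro h₃
      cases k with
      | zero => exact hvl rfl
      | succ k =>
        exact R.parent_ne_leaf hr h₃ (iterate_ne_root hr (show k < _ by omega))
          (Function.iterate_succ_apply' p k l).symm
    omega
  · rintro n ⟨a, b, P, hP, hmem, hint, rfl⟩
    by_cases ha : l = a
    · subst ha
      exact R.length_le_chainLength hr hl P hP hint
    by_cases hb : l = b
    · subst hb
      rw [← P.length_reverse]
      refine R.length_le_chainLength hr hl P.reverse hP.reverse fun v hv hvl hva => ?_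
      exact hint v (by simpa using hv) hva hvl
    · have := hint l hmem ha hb
      omega

end IsRooting

/-- The vertices within fewer than `j l` parent steps of some leaf `l`. -/
noncomputable def chainSet {V : Type*} [Fintype V] (T : SimpleGraph V) (p : V → V) (j : V → ℕ) :
    Finset V :=
  (leaves T).biUnion fun l => (Finset.range (j l)).image fun i => p^[i] l

/-- The parent-closed sets containing all vertices of degree at least `3` and no leaf. -/
noncomputable def prunedSets {V : Type*} [Fintype V] (T : SimpleGraph V) (p : V → V) :
    Finset (Finset V) :=
  Finset.univ.filter fun W =>
    (∀ x ∈ W, p x ∈ W) ∧ (∀ v, 3 ≤ T.degree v → v ∈ W) ∧ ∀ v ∈ W, T.degree v ≠ 1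

theorem mem_chainSet {V : Type*} [Fintype V] {T : SimpleGraph V} {p : V → V} {j : V → ℕ} {x : V} :
    x ∈ chainSet T p j ↔ ∃ l, T.degree l = 1 ∧ ∃ i < j l, p^[i] l = x := by
  simp [chainSet, leaves]

namespace IsRooting

variable {V : Type*} [Fintype V] {T : SimpleGraph V} {r : V} {p : V → V} {h : V → ℕ}

theorem card_chainSet (R : IsRooting T r p h) (hr : 3 ≤ T.degree r) {j : V → ℕ}
    (hj : ∀ l, T.degree l = 1 → j l ≤ chainLength T p l) :
    (chainSet T p j).card = ∑ l ∈ leaves T, j l := by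
  have hmem : ∀ {l}, l ∈ leaves T → T.degree l = 1 := fun hl => (Finset.mem_filter.1 hl).2
  rw [chainSet, Finset.card_biUnion]
  · refine Finset.sum_congr rfl fun l hl => ?_
    rw [Finset.card_image_of_injOn, Finset.card_range]
    intro i hi k hk he
    simp only [Finset.coe_range, Set.mem_Iio] at hi hk
    have := hj l (hmem hl)
    exact (R.chain_injective hr (hmem hl) (hmem hl) (by omega) (by omega) he).1
  · intro l hl l' hl' hne
    rw [Function.onFun, Finset.disjoint_left]
    rintro x hx hx'
    obtain ⟨i, hi, rfl⟩ := Finset.mem_image.1 hx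
    obtain ⟨k, hk, he⟩ := Finset.mem_image.1 hx'
    rw [Finset.mem_range] at hi hk
    have h₁ := hj l (hmem hl)
    have h₂ := hj l' (hmem hl')
    exact hne (R.chain_injective hr (hmem hl) (hmem hl') (by omega) (by omega) he.symm).2

theorem parent_notMem_chainSet (R : IsRooting T r p h) (hr : 3 ≤ T.degree r) {j : V → ℕ}
    (hj : ∀ l, T.degree l = 1 → j l ≤ chainLength T p l) {x : V} (hx : x ∉ chainSet T p j) :
    p x ∉ chainSet T p j := by
  by_cases hxr : x = r
  · rwa [hxr, R.parent_root, ← hxr]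
  rw [mem_chainSet]
  rintro ⟨l, hl, i, hi, he⟩
  have hle := hj l hl
  cases i with
  | zero => exact R.parent_ne_leaf hr hl hxr he.symm
  | succ i =>
    have hne := iterate_ne_root hr (show i + 1 < chainLength T p l by omega)
    have hd := degree_iterate_le_two (show i + 1 < chainLength T p l by omega)
    refine hx (mem_chainSet.2 ⟨l, hl, i, by omega, ?_⟩)
    exact R.child_unique hne hd (iterate_ne_root hr (show i < _ by omega)) hxr
      (Function.iterate_succ_apply' p i l).symm he.symm

theorem notMem_chainSet {j : V → ℕ}
    (hj : ∀ l, T.degree l = 1 → j l ≤ chainLength T p l) {v : V} (hv : 3 ≤ T.degree v) :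
    v ∉ chainSet T p j := by
  rw [mem_chainSet]
  rintro ⟨l, hl, i, hi, rfl⟩
  have := degree_iterate_le_two (hi.trans_le (hj l hl))
  omega

theorem trunk_card (R : IsRooting T r p h) (hr : 3 ≤ T.degree r) {A : Finset V}
    (hA : IsTrunk T A) : A.card + ∑ l ∈ leaves T, chainLength T p l = Fintype.card V := by
  obtain ⟨hconn, hdeg, hmin⟩ := hA
  have hA' : A = (chainSet T p (chainLength T p))ᶜ := by
    apply subset_antisymm
    · refine hmin _ (R.connected_induce ?_ ?_) fun v hv => ?_
      · simpa using notMem_chainSet (fun _ _ => le_rfl) hr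
      · intro x hx
        rw [Finset.mem_coe, Finset.mem_compl] at hx ⊢
        exact R.parent_notMem_chainSet hr (fun _ _ => le_rfl) hx
      · simpa using notMem_chainSet (fun _ _ => le_rfl) hv
    · intro x hx
      by_contra hxA
      rw [Finset.mem_compl, mem_chainSet] at hx
      exact hx (R.exists_chain_of_notMem hr (W := (A : Set V))
        (fun x hx => R.parent_mem_of_connected (hdeg r hr) hconn hx) hdeg hxA)
  rw [hA', ← R.card_chainSet hr (fun _ _ => le_rfl), Finset.card_compl_add_card]

theorem sum_prunedSets (R : IsRooting T r p h) (hr : 3 ≤ T.degree r) {K : Type*} [CommSemiring K]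
    (q : K) : ∑ W ∈ prunedSets T p, q ^ Wᶜ.card =
      ∏ l ∈ leaves T, ∑ i ∈ Finset.Icc 1 (chainLength T p l), q ^ i := by
  set t : V → Finset ℕ := fun l => if T.degree l = 1 then Finset.Icc 1 (chainLength T p l) else {0}
    with ht
  have ht₁ : ∀ {j : V → ℕ}, j ∈ Fintype.piFinset t → ∀ l, T.degree l = 1 →
      1 ≤ j l ∧ j l ≤ chainLength T p l := by
    intro j hj l hl
    have := Fintype.mem_piFinset.1 hj l
    simpa [ht, hl] using this
  have ht₀ : ∀ {j : V → ℕ}, j ∈ Fintype.piFinset t → ∀ l, T.degree l ≠ 1 → j l = 0 := by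
    intro j hj l hl
    have := Fintype.mem_piFinset.1 hj l
    simpa [ht, hl] using this
  have hprod : ∏ l ∈ leaves T, ∑ i ∈ Finset.Icc 1 (chainLength T p l), q ^ i =
      ∏ l, ∑ i ∈ t l, q ^ i := by
    rw [leaves, Finset.prod_filter]
    refine Finset.prod_congr rfl fun l _ => ?_
    by_cases hl : T.degree l = 1 <;> simp [ht, hl]
  rw [hprod, Finset.prod_univ_sum]
  symm
  refine Finset.sum_bij (fun j _ => (chainSet T p j)ᶜ) ?_ ?_ ?_ ?_
  · intro j hj
    have hj' := fun l hl => (ht₁ hj l hl).2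
    simp only [prunedSets, Finset.mem_filter, Finset.mem_univ, true_and, Finset.mem_compl]
    refine ⟨fun x hx => R.parent_notMem_chainSet hr hj' hx, fun v hv => notMem_chainSet hj' hv,
      fun v hv hd => hv (mem_chainSet.2 ⟨v, hd, 0, (ht₁ hj v hd).1, rfl⟩)⟩
  · have hle : ∀ {j j' : V → ℕ}, j ∈ Fintype.piFinset t → j' ∈ Fintype.piFinset t →
        chainSet T p j = chainSet T p j' → ∀ l, T.degree l = 1 → j' l ≤ j l := by
      intro j j' hj hj' he l hl
      by_contra! hlt
      have hmem : p^[j l] l ∈ chainSet T p j := by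
        rw [he]
        exact mem_chainSet.2 ⟨l, hl, j l, hlt, rfl⟩
      obtain ⟨l', hl', i, hi, hii⟩ := mem_chainSet.1 hmem
      obtain ⟨rfl, rfl⟩ := R.chain_injective hr hl' hl (hi.trans_le (ht₁ hj l' hl').2)
        (hlt.trans_le (ht₁ hj' l hl).2) hii
      exact lt_irrefl _ hi
    intro j hj j' hj' he
    have he' := compl_injective he
    funext l
    by_cases hl : T.degree l = 1
    · exact le_antisymm (hle hj' hj he'.symm l hl) (hle hj hj' he' l hl)
    · rw [ht₀ hj l hl, ht₀ hj' l hl]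
  · intro W hW
    simp only [prunedSets, Finset.mem_filter, Finset.mem_univ, true_and] at hW
    obtain ⟨hpW, hdW, hlW⟩ := hW
    have hmem : ∀ l, p^[sInf {i | p^[i] l ∈ W}] l ∈ W := fun l =>
      Nat.sInf_mem (s := {i | p^[i] l ∈ W}) ⟨_, hdW _ (R.three_le_degree_iterate hr l)⟩
    refine ⟨fun l => if T.degree l = 1 then sInf {i | p^[i] l ∈ W} else 0, ?_, ?_⟩
    · rw [Fintype.mem_piFinset]
      intro l
      by_cases hl : T.degree l = 1
      · simp only [ht, hl, if_true, Finset.mem_Icc]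
        refine ⟨Nat.one_le_iff_ne_zero.2 fun h0 => ?_,
          Nat.sInf_le (hdW _ (R.three_le_degree_iterate hr l))⟩
        have := hmem l
        rw [h0] at this
        exact hlW l this hl
      · simp [ht, hl]
    · rw [compl_eq_comm]
      ext x
      rw [Finset.mem_compl, mem_chainSet]
      constructor
      · intro hx
        obtain ⟨l, hl, i, -, rfl⟩ := R.exists_chain_of_notMem hr (W := (W : Set V)) hpW hdW hx
        refine ⟨l, hl, i, ?_, rfl⟩
        rw [if_pos hl]
        by_contra! hle
        exact hx (iterate_mem_of_le (W := (W : Set V)) hpW hle (hmem l))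
      · rintro ⟨l, hl, i, hi, rfl⟩
        rw [if_pos hl] at hi
        exact Nat.notMem_of_lt_sInf (s := {i | p^[i] l ∈ W}) hi
  · intro j hj
    rw [compl_compl, R.card_chainSet hr (fun l hl => (ht₁ hj l hl).2), Finset.prod_pow_eq_pow_sum]
    congr 1
    symm
    refine Finset.sum_subset (Finset.subset_univ _) fun l _ hl => ht₀ hj l ?_
    simpa [leaves] using hl

end IsRooting

theorem eval_geom_eq_zero_iff {m a : ℕ} {ζ : ℂ} (hζ : IsPrimitiveRoot ζ m) (hm : 2 ≤ m) :
    (∑ i ∈ Finset.Icc 1 a, (Polynomial.X : Polynomial ℂ) ^ i).eval ζ = 0 ↔ m ∣ a := by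
  have h1 : ζ - 1 ≠ 0 := sub_ne_zero.2 (hζ.ne_one (by omega))
  have h0 : ζ ≠ 0 := hζ.ne_zero (by omega)
  have he : (∑ i ∈ Finset.Icc 1 a, (Polynomial.X : Polynomial ℂ) ^ i).eval ζ * (ζ - 1) =
      ζ * (ζ ^ a - 1) := by
    rw [← geom_sum_mul, ← mul_assoc, Finset.mul_sum, Polynomial.eval_finsetSum,
      Finset.range_eq_Ico, ← Finset.Ico_add_one_right_eq_Icc, Finset.sum_Ico_eq_sum_range,
      Finset.sum_Ico_eq_sum_range]
    simp [pow_add]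
  rw [← hζ.pow_eq_one_iff_dvd, ← sub_eq_zero (a := ζ ^ a), ← mul_eq_zero_iff_right h1, he,
    mul_eq_zero_iff_left h0]

theorem Multiset.eq_of_prod_geom_eq {s t : Multiset ℕ} (hs : ∀ a ∈ s, 1 ≤ a) (ht : ∀ a ∈ t, 1 ≤ a)
    (he : (s.map fun a => ∑ i ∈ Finset.Icc 1 a, (Polynomial.X : Polynomial ℂ) ^ i).prod =
      (t.map fun a => ∑ i ∈ Finset.Icc 1 a, (Polynomial.X : Polynomial ℂ) ^ i).prod) : s = t := by
  have key : ∀ {m : ℕ} {s t : Multiset ℕ}, 2 ≤ m → (∀ a ∈ t, 1 ≤ a ∧ a ≤ m) → m ∈ s →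
      (s.map fun a => ∑ i ∈ Finset.Icc 1 a, (Polynomial.X : Polynomial ℂ) ^ i).prod =
      (t.map fun a => ∑ i ∈ Finset.Icc 1 a, (Polynomial.X : Polynomial ℂ) ^ i).prod → m ∈ t := by
    intro m s t hm ht hms he
    have hζ := Complex.isPrimitiveRoot_exp m (by omega)
    have h0 := congrArg (Polynomial.eval (Complex.exp (2 * Real.pi * Complex.I / m))) he
    rw [← Multiset.cons_erase hms, Multiset.map_cons, Multiset.prod_cons, Polynomial.eval_mul,
      (eval_geom_eq_zero_iff hζ hm).2 dvd_rfl, zero_mul, Polynomial.eval_multiset_prod, eq_comm,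
      Multiset.prod_eq_zero_iff, Multiset.map_map, Multiset.mem_map] at h0
    obtain ⟨b, hb, hb0⟩ := h0
    have hdvd := (eval_geom_eq_zero_iff hζ hm).1 hb0
    have := Nat.le_of_dvd (ht b hb).1 hdvd
    rwa [← le_antisymm (ht b hb).2 this]
  induction hn : s.card using Nat.strong_induction_on generalizing s t with
  | _ n ih =>
    by_cases hbig : ∃ a ∈ s + t, 2 ≤ a
    · obtain ⟨a, ha, ha2⟩ := hbig
      obtain ⟨m, hm, hmax⟩ := (s + t).toFinset.exists_max_image id ⟨a, Multiset.mem_toFinset.2 ha⟩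
      have hmax' : ∀ b ∈ s + t, b ≤ m := fun b hb => hmax b (Multiset.mem_toFinset.2 hb)
      have hm2 : 2 ≤ m := ha2.trans (hmax' a ha)
      have hs' : ∀ b ∈ s, 1 ≤ b ∧ b ≤ m :=
        fun b hb => ⟨hs b hb, hmax' b (Multiset.mem_add.2 (Or.inl hb))⟩
      have ht' : ∀ b ∈ t, 1 ≤ b ∧ b ≤ m :=
        fun b hb => ⟨ht b hb, hmax' b (Multiset.mem_add.2 (Or.inr hb))⟩
      have hmst : m ∈ s ∧ m ∈ t := by
        rcases Multiset.mem_add.1 (Multiset.mem_toFinset.1 hm) with hms | hmt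
        · exact ⟨hms, key hm2 ht' hms he⟩
        · exact ⟨key hm2 hs' hmt he.symm, hmt⟩
      have h0 : ∑ i ∈ Finset.Icc 1 m, (Polynomial.X : Polynomial ℂ) ^ i ≠ 0 := by
        intro h0
        have := congrArg (Polynomial.eval 1) h0
        simp [Polynomial.eval_finsetSum] at this
        omega
      rw [← Multiset.cons_erase hmst.1, ← Multiset.cons_erase hmst.2]
      rw [← Multiset.cons_erase hmst.1, ← Multiset.cons_erase hmst.2, Multiset.map_cons,
        Multiset.map_cons, Multiset.prod_cons, Multiset.prod_cons] at he
      rw [ih _ (by rw [← hn]; exact Multiset.card_erase_lt_of_mem hmst.1)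
        (fun b hb => hs b (Multiset.mem_of_mem_erase hb))
        (fun b hb => ht b (Multiset.mem_of_mem_erase hb)) (mul_left_cancel₀ h0 he) rfl]
    · push Not at hbig
      have hs1 : s = Multiset.replicate s.card 1 := Multiset.eq_replicate_card.2 fun b hb =>
        le_antisymm (Nat.le_of_lt_succ (hbig b (Multiset.mem_add.2 (Or.inl hb)))) (hs b hb)
      have ht1 : t = Multiset.replicate t.card 1 := Multiset.eq_replicate_card.2 fun b hb =>
        le_antisymm (Nat.le_of_lt_succ (hbig b (Multiset.mem_add.2 (Or.inr hb)))) (ht b hb)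
      rw [hs1, ht1] at he ⊢
      have := congrArg Polynomial.natDegree he
      simp only [Multiset.map_replicate, Multiset.prod_replicate, Finset.Icc_self,
        Finset.sum_singleton, pow_one, Polynomial.natDegree_X_pow] at this
      rw [this]

theorem sum_filter_eq_of_sum_mul_pow_eq {ι ι' : Type*} {s : Finset ι} {s' : Finset ι'} {c : ι → ℚ}
    {c' : ι' → ℚ} {e : ι → ℕ} {e' : ι' → ℕ} {S : Set ℚ} (hS : S.Infinite)
    (H : ∀ x ∈ S, ∑ i ∈ s, c i * x ^ e i = ∑ i ∈ s', c' i * x ^ e' i) (k : ℕ) :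
    ∑ i ∈ s.filter (fun i => e i = k), c i = ∑ i ∈ s'.filter (fun i => e' i = k), c' i := by
  have hP : ∑ i ∈ s, Polynomial.C (c i) * Polynomial.X ^ e i =
      ∑ i ∈ s', Polynomial.C (c' i) * Polynomial.X ^ e' i := by
    refine Polynomial.eq_of_infinite_eval_eq _ _ (hS.mono fun x hx => ?_)
    simpa [Polynomial.eval_finsetSum] using H x hx
  have := congrArg (fun P => Polynomial.coeff P k) hP
  simpa [Polynomial.finsetSum_coeff, Polynomial.coeff_C_mul, Polynomial.coeff_X_pow,
    Finset.sum_filter, eq_comm] using this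

/-- The proper colorings with colors below `a + b`, in which `k` vertices have colors below `a`. -/
noncomputable def boundedColorings {V : Type*} [Fintype V] (T : SimpleGraph V) (a b k : ℕ) :
    Finset (V → ℕ) :=
  (Fintype.piFinset fun _ => Finset.range (a + b)).filter fun κ =>
    Proper T κ ∧ (Finset.univ.filter fun v => κ v < a).card = k

/-- The exponent vector of the monomial of a coloring. -/
noncomputable def colorContent {V : Type*} [Fintype V] (κ : V → ℕ) : ℕ →₀ ℕ :=
  ∑ v, Finsupp.single (κ v) 1

section Coloring

variable {V : Type*} [Fintype V] {T : SimpleGraph V} {a b k : ℕ}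

theorem colorContent_apply (κ : V → ℕ) (i : ℕ) :
    colorContent κ i = (Finset.univ.filter fun v => κ v = i).card := by
  simp [colorContent, Finsupp.finsetSum_apply, Finsupp.single_apply]

theorem sum_colorContent (κ : V → ℕ) (a : ℕ) :
    ∑ i ∈ Finset.range a, colorContent κ i = (Finset.univ.filter fun v => κ v < a).card := by
  rw [Finset.card_eq_sum_card_fiberwise (f := κ) (t := Finset.range a)]
  · refine Finset.sum_congr rfl fun i hi => ?_
    rw [colorContent_apply, Finset.filter_filter]
    congr 1
    ext v
    have := Finset.mem_range.1 hi
    simp only [Finset.mem_filter, Finset.mem_univ, true_and]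
    omega
  · intro v hv
    simpa using hv

theorem forall_lt_iff_colorContent (κ : V → ℕ) (N : ℕ) :
    (∀ v, κ v < N) ↔ ∀ i, N ≤ i → colorContent κ i = 0 := by
  simp only [colorContent_apply, Finset.card_eq_zero, Finset.filter_eq_empty_iff, Finset.mem_univ,
    true_imp_iff]
  constructor
  · intro hv i hi v he
    have := hv v
    omega
  · intro hi v
    by_contra! hle
    exact hi _ hle rfl

theorem mem_boundedColorings {κ : V → ℕ} : κ ∈ boundedColorings T a b k ↔ Proper T κ ∧
    (∀ i, a + b ≤ i → colorContent κ i = 0) ∧ ∑ i ∈ Finset.range a, colorContent κ i = k := by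
  rw [← forall_lt_iff_colorContent, sum_colorContent, boundedColorings, Finset.mem_filter,
    Fintype.mem_piFinset]
  simp only [Finset.mem_range]
  tauto

theorem card_filter_boundedColorings {m : ℕ →₀ ℕ} (hm : ∀ i, a + b ≤ i → m i = 0)
    (hk : ∑ i ∈ Finset.range a, m i = k) :
    (((boundedColorings T a b k).filter fun κ => colorContent κ = m).card : ℤ) = csf T m := by
  rw [csf, Nat.subtype_card]
  intro κ
  have hc : (∀ i, Nat.card {v // κ v = i} = m i) ↔ colorContent κ = m := by
    rw [DFunLike.ext_iff]
    refine forall_congr' fun i => ?_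
    rw [colorContent_apply, Nat.card_eq_fintype_card, Fintype.card_subtype]
  rw [hc, Finset.mem_filter, mem_boundedColorings]
  constructor
  · rintro ⟨⟨h₁, -⟩, h₂⟩
    exact ⟨h₁, h₂⟩
  · rintro ⟨h₁, rfl⟩
    exact ⟨⟨h₁, hm, hk⟩, rfl⟩

theorem card_boundedColorings_eq {V' : Type*} [Fintype V'] {T' : SimpleGraph V'}
    (h : csf T = csf T') (a b k : ℕ) :
    (boundedColorings T a b k).card = (boundedColorings T' a b k).card := by
  set M := (boundedColorings T a b k).image colorContent ∪
    (boundedColorings T' a b k).image colorContent with hM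
  have hM₁ : ∀ m ∈ M, (∀ i, a + b ≤ i → m i = 0) ∧ ∑ i ∈ Finset.range a, m i = k := by
    intro m hm
    rcases Finset.mem_union.1 hm with hm | hm <;>
    · obtain ⟨κ, hκ, rfl⟩ := Finset.mem_image.1 hm
      exact (mem_boundedColorings.1 hκ).2
  rw [Finset.card_eq_sum_card_fiberwise (f := colorContent)
    (s := boundedColorings T a b k) (t := M),
    Finset.card_eq_sum_card_fiberwise (f := colorContent) (s := boundedColorings T' a b k) (t := M)]
  · refine Finset.sum_congr rfl fun m hm => ?_
    obtain ⟨h₁, h₂⟩ := hM₁ m hm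
    have e₁ := card_filter_boundedColorings (T := T) h₁ h₂
    have e₂ := card_filter_boundedColorings (T := T') h₁ h₂
    rw [h, ← e₂] at e₁
    exact_mod_cast e₁
  · exact fun κ hκ => Finset.mem_union_right _ (Finset.mem_image_of_mem _ hκ)
  · exact fun κ hκ => Finset.mem_union_left _ (Finset.mem_image_of_mem _ hκ)

theorem card_eq_of_csf_eq {V' : Type*} [Fintype V'] {T' : SimpleGraph V'}
    (h : csf T = csf T') : Fintype.card V = Fintype.card V' := by
  have hc := card_boundedColorings_eq h (Fintype.card V) 0 (Fintype.card V)
  have hpos : 0 < (boundedColorings T (Fintype.card V) 0 (Fintype.card V)).card := by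
    refine Finset.card_pos.2 ⟨fun v => Fintype.equivFin V v, ?_⟩
    rw [boundedColorings, Finset.mem_filter, Fintype.mem_piFinset]
    refine ⟨fun v => by simp, fun u v huv he => ?_, by simp [Finset.card_univ]⟩
    exact huv.ne ((Fintype.equivFin V).injective (Fin.ext he))
  obtain ⟨κ, hκ⟩ := Finset.card_pos.1 (hc ▸ hpos)
  rw [boundedColorings, Finset.mem_filter, Fintype.mem_piFinset] at hκ
  obtain ⟨h₁, -, h₂⟩ := hκ
  rw [← h₂, ← Finset.card_univ (α := V')]
  congr 1
  ext v
  simpa using h₁ v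

end Coloring

/-- The number of edges joining two vertices of `W`, for a tree with parent map `p`. -/
noncomputable def innerEdges {V : Type*} [Fintype V] (r : V) (p : V → V) (W : Finset V) : ℕ :=
  (Finset.univ.filter fun x => x ≠ r ∧ x ∈ W ∧ p x ∈ W).card

namespace IsRooting

variable {V : Type*} [Fintype V] {T : SimpleGraph V} {r : V} {p : V → V} {h : V → ℕ}

/-- Choosing colors in order of increasing depth: the number of colorings whose color classes on
each side of `W` are disjoint intervals of lengths `a` and `b`. -/
theorem card_fiber_boundedColorings (R : IsRooting T r p h) {a b : ℕ} (ha : 0 < a) (hb : 0 < b)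
    (W : Finset V) :
    ((boundedColorings T a b W.card).filter fun κ =>
      (Finset.univ.filter fun v => κ v < a) = W).card =
      ∏ x, ((if x ∈ W then a else b) -
        if x ≠ r ∧ (x ∈ W ↔ p x ∈ W) then 1 else 0) := by
  set side : V → Finset ℕ := fun x => if x ∈ W then Finset.Ico 0 a else Finset.Ico a (a + b)
    with hside
  set base : V → ℕ := fun x => if x ∈ W then 0 else a with hbase
  set S : V → Prop := fun x => x ≠ r ∧ (x ∈ W ↔ p x ∈ W) with hS
  set D : V → Finset ℕ := fun x => if S x then (side x).erase (base x) else side x with hD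
  set Φ : (V → ℕ) → V → ℕ := fun κ x =>
    if S x then Equiv.swap (κ (p x)) (base x) (κ x) else κ x with hΦ
  have hbs : ∀ x, base x ∈ side x := by
    intro x
    by_cases hx : x ∈ W <;> simp [hbase, hside, hx, ha, hb]
  have hsS : ∀ x, S x → side (p x) = side x := by
    intro x hx
    simp only [hside, hx.2]
  have hswap : ∀ {s : Finset ℕ} {y z c : ℕ}, y ∈ s → z ∈ s → (Equiv.swap y z c ∈ s ↔ c ∈ s) := by
    intro s y z c hy hz
    by_cases h₁ : c = y
    · subst h₁; simp [hy, hz]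
    by_cases h₂ : c = z
    · subst h₂; simp [hy, hz]
    rw [Equiv.swap_apply_of_ne_of_ne h₁ h₂]
  have hinj : Function.Injective Φ := by
    intro κ κ' he
    funext x
    induction hn : h x using Nat.strong_induction_on generalizing x with
    | _ n ih =>
      have hx := congrFun he x
      by_cases hS' : S x
      · have hd := R.depth_parent x hS'.1
        simp only [hΦ, if_pos hS'] at hx
        rw [ih (h (p x)) (by omega) (p x) rfl] at hx
        exact (Equiv.injective _) hx
      · simpa only [hΦ, if_neg hS'] using hx
  have hside_lt : ∀ {x c}, c ∈ side x → c < a + b := by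
    intro x c hc
    by_cases hx : x ∈ W <;> simp [hside, hx] at hc <;> omega
  set B : Finset (V → ℕ) := Fintype.piFinset fun _ => Finset.range (a + b) with hB
  have himg : B.image Φ = B := by
    refine Finset.eq_of_subset_of_card_le ?_ (Finset.card_image_of_injective _ hinj).ge
    intro δ hδ
    obtain ⟨κ, hκ, rfl⟩ := Finset.mem_image.1 hδ
    rw [hB, Fintype.mem_piFinset] at hκ ⊢
    intro x
    simp only [hΦ]
    split_ifs
    · exact (hswap (hκ _) (Finset.mem_range.2 (hside_lt (hbs x)))).2 (hκ x)
    · exact hκ x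
  have hmem : ∀ κ, κ ∈ (boundedColorings T a b W.card).filter
      (fun κ => (Finset.univ.filter fun v => κ v < a) = W) ↔
      ∀ x, κ x ∈ side x ∧ (S x → κ x ≠ κ (p x)) := by
    intro κ
    rw [Finset.mem_filter, boundedColorings, Finset.mem_filter, Fintype.mem_piFinset]
    constructor
    · rintro ⟨⟨hlt, hprop, -⟩, hW⟩ x
      refine ⟨?_, fun hx => hprop (R.adj_parent hx.1)⟩
      have hxW : κ x < a ↔ x ∈ W := by rw [← hW]; simp
      have := Finset.mem_range.1 (hlt x)
      by_cases hx : x ∈ W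
      · simpa [hside, hx] using hxW.2 hx
      · simp only [hside, hx, if_false, Finset.mem_Ico]
        exact ⟨not_lt.1 (mt hxW.1 hx), this⟩
    · intro hκ
      have hxW : ∀ x, κ x < a ↔ x ∈ W := by
        intro x
        have := (hκ x).1
        by_cases hx : x ∈ W <;> simp [hside, hx] at this <;> simp [hx] <;> omega
      have hpar : ∀ x, x ≠ r → κ x ≠ κ (p x) := by
        intro x hx he
        by_cases hS' : S x
        · exact (hκ x).2 hS' he
        · exact hS' ⟨hx, by rw [← hxW, ← hxW, he]⟩
      have hfil : (Finset.univ.filter fun v => κ v < a) = W := by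
        ext v; simpa using hxW v
      refine ⟨⟨fun x => Finset.mem_range.2 (hside_lt (hκ x).1), fun u v huv => ?_, ?_⟩, hfil⟩
      · rcases (R.adj_iff u v).1 huv with ⟨hu, rfl⟩ | ⟨hv, rfl⟩
        · exact hpar u hu
        · exact (hpar v hv).symm
      · rw [hfil]
  have hΦD : ∀ κ, (∀ x, κ x ∈ side x ∧ (S x → κ x ≠ κ (p x))) ↔ Φ κ ∈ Fintype.piFinset D := by
    intro κ
    have hne : ∀ {y z c : ℕ}, Equiv.swap y z c ≠ z ↔ c ≠ y := by
      intro y z c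
      rw [Ne, Equiv.swap_apply_eq_iff, Equiv.swap_apply_right]
    rw [Fintype.mem_piFinset]
    constructor
    · intro hκ x
      by_cases hS' : S x
      · simp only [hΦ, hD, if_pos hS', Finset.mem_erase]
        exact ⟨hne.2 ((hκ x).2 hS'),
          (hswap (by rw [← hsS x hS']; exact (hκ (p x)).1) (hbs x)).2 (hκ x).1⟩
      · simpa only [hΦ, hD, if_neg hS'] using (hκ x).1
    · intro hκ x
      induction hn : h x using Nat.strong_induction_on generalizing x with
      | _ n ih =>
        have hx := hκ x
        by_cases hS' : S x
        · have hd := R.depth_parent x hS'.1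
          simp only [hΦ, hD, if_pos hS', Finset.mem_erase] at hx
          have hpx := (ih (h (p x)) (by omega) (p x) rfl).1
          rw [hsS x hS'] at hpx
          exact ⟨(hswap hpx (hbs x)).1 hx.2, fun _ => hne.1 hx.1⟩
        · simp only [hΦ, hD, if_neg hS'] at hx
          exact ⟨hx, fun hc => absurd hc hS'⟩
  have hFD : ((boundedColorings T a b W.card).filter
      (fun κ => (Finset.univ.filter fun v => κ v < a) = W)).image Φ = Fintype.piFinset D := by
    ext δ
    rw [Finset.mem_image]
    constructor
    · rintro ⟨κ, hκ, rfl⟩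
      exact (hΦD κ).1 ((hmem κ).1 hκ)
    · intro hδ
      have hδB : δ ∈ B.image Φ := by
        rw [himg, hB, Fintype.mem_piFinset]
        intro x
        have hx := Fintype.mem_piFinset.1 hδ x
        refine Finset.mem_range.2 (hside_lt (x := x) ?_)
        simp only [hD] at hx
        split_ifs at hx
        · exact Finset.mem_of_mem_erase hx
        · exact hx
      obtain ⟨κ, -, rfl⟩ := Finset.mem_image.1 hδB
      exact ⟨κ, (hmem κ).2 ((hΦD κ).2 hδ), rfl⟩
  rw [← Finset.card_image_of_injective _ hinj, hFD, Fintype.card_piFinset]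
  refine Finset.prod_congr rfl fun x _ => ?_
  have hcard : (side x).card = if x ∈ W then a else b := by
    by_cases hx : x ∈ W <;> simp [hside, hx]
  simp only [hD]
  by_cases hS' : S x
  · rw [if_pos hS', Finset.card_erase_of_mem (hbs x), hcard, if_pos hS']
  · rw [if_neg hS', hcard, if_neg hS', Nat.sub_zero]

theorem card_fiber_boundedColorings_rat (R : IsRooting T r p h) {a b : ℕ} (ha : 0 < a) (hb : 0 < b)
    (W : Finset V) :
    (((boundedColorings T a b W.card).filter
      fun κ => (Finset.univ.filter fun v => κ v < a) = W).card : ℚ) =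
      a ^ W.card * b ^ (Fintype.card V - W.card) *
        ((1 - (a : ℚ)⁻¹) ^ innerEdges r p W * (1 - (b : ℚ)⁻¹) ^ innerEdges r p Wᶜ) := by
  have ha' : (a : ℚ) ≠ 0 := by positivity
  have hb' : (b : ℚ) ≠ 0 := by positivity
  have hcard : ∀ (U : Finset V) (c : ℚ), c ^ U.card = ∏ x, if x ∈ U then c else 1 := by
    intro U c
    rw [← Finset.prod_const, ← Finset.prod_filter]
    simp
  rw [R.card_fiber_boundedColorings ha hb, Nat.cast_prod, ← Finset.card_compl, innerEdges,
    innerEdges, hcard, hcard, hcard, hcard, ← Finset.prod_mul_distrib, ← Finset.prod_mul_distrib,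
    ← Finset.prod_mul_distrib]
  refine Finset.prod_congr rfl fun x _ => ?_
  rcases eq_or_ne x r with rfl | hxr
  · by_cases hx : x ∈ W <;> simp [hx]
  · by_cases hx : x ∈ W <;> by_cases hpx : p x ∈ W <;>
      simp [hxr, hx, hpx, Nat.cast_pred ha, Nat.cast_pred hb] <;> field_simp

end IsRooting

/-- The size of a vertex set and the numbers of edges inside it and inside its complement. -/
noncomputable def edgeStats {V : Type*} [Fintype V] (r : V) (p : V → V) (W : Finset V) :
    ℕ × ℕ × ℕ :=
  (W.card, innerEdges r p W, innerEdges r p Wᶜ)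

theorem infinite_range_one_sub_inv : (Set.range fun n : ℕ => 1 - ((n + 1 : ℕ) : ℚ)⁻¹).Infinite := by
  refine Set.infinite_range_of_injective fun m n he => ?_
  simpa using he

theorem count_edgeStats {V : Type*} [Fintype V] (r : V) (p : V → V) (k i j : ℕ) :
    Multiset.count (k, i, j) ((Finset.univ : Finset (Finset V)).val.map (edgeStats r p)) =
      (((Finset.powersetCard k (Finset.univ : Finset V)).filter
        fun W => innerEdges r p W = i).filter fun W => innerEdges r p Wᶜ = j).card := by
  rw [Multiset.count_map, ← Finset.filter_val, Finset.card_val]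
  congr 1
  ext W
  simp only [Finset.mem_filter, Finset.mem_univ, true_and, Finset.mem_powersetCard,
    Finset.subset_univ, edgeStats, Prod.mk.injEq, eq_comm (a := k), eq_comm (a := i),
    eq_comm (a := j), and_assoc]

namespace IsRooting

variable {V : Type*} [Fintype V] {T : SimpleGraph V} {r : V} {p : V → V} {h : V → ℕ}

theorem card_boundedColorings (R : IsRooting T r p h) {a b : ℕ} (ha : 0 < a) (hb : 0 < b) (k : ℕ) :
    ((boundedColorings T a b k).card : ℚ) = a ^ k * b ^ (Fintype.card V - k) *
      ∑ W ∈ Finset.powersetCard k (Finset.univ : Finset V),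
        (1 - (b : ℚ)⁻¹) ^ innerEdges r p Wᶜ * (1 - (a : ℚ)⁻¹) ^ innerEdges r p W := by
  rw [Finset.card_eq_sum_card_fiberwise (f := fun κ => Finset.univ.filter fun v => κ v < a)
    (t := Finset.powersetCard k Finset.univ), Nat.cast_sum, Finset.mul_sum]
  · refine Finset.sum_congr rfl fun W hW => ?_
    obtain rfl := (Finset.mem_powersetCard.1 hW).2
    rw [R.card_fiber_boundedColorings_rat ha hb, mul_comm ((1 - (b : ℚ)⁻¹) ^ _)]
  · intro κ hκ
    exact Finset.mem_coe.2 (Finset.mem_powersetCard.2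
      ⟨Finset.subset_univ _, (Finset.mem_filter.1 hκ).2.2⟩)

theorem map_edgeStats_eq {V' : Type*} [Fintype V'] {T' : SimpleGraph V'} {r' : V'} {p' : V' → V'}
    {h' : V' → ℕ} (R : IsRooting T r p h) (R' : IsRooting T' r' p' h') (hcsf : csf T = csf T') :
    (Finset.univ : Finset (Finset V)).val.map (edgeStats r p) =
      (Finset.univ : Finset (Finset V')).val.map (edgeStats r' p') := by
  ext ⟨k, i, j⟩
  have hsum : ∀ y ∈ Set.range fun n : ℕ => 1 - ((n + 1 : ℕ) : ℚ)⁻¹,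
      ∀ x ∈ Set.range fun n : ℕ => 1 - ((n + 1 : ℕ) : ℚ)⁻¹,
      ∑ W ∈ Finset.powersetCard k (Finset.univ : Finset V),
        y ^ innerEdges r p Wᶜ * x ^ innerEdges r p W =
      ∑ W ∈ Finset.powersetCard k (Finset.univ : Finset V'),
        y ^ innerEdges r' p' Wᶜ * x ^ innerEdges r' p' W := by
    rintro _ ⟨b, rfl⟩ _ ⟨a, rfl⟩
    have h₁ := R.card_boundedColorings a.succ_pos b.succ_pos k
    have h₂ := R'.card_boundedColorings a.succ_pos b.succ_pos k
    rw [card_boundedColorings_eq hcsf, h₂, card_eq_of_csf_eq hcsf] at h₁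
    exact (mul_left_cancel₀ (by positivity) h₁).symm
  have h₁ := fun y hy =>
    sum_filter_eq_of_sum_mul_pow_eq infinite_range_one_sub_inv (hsum y hy) i
  have h₂ := sum_filter_eq_of_sum_mul_pow_eq (c := fun _ => 1) (c' := fun _ => 1)
    infinite_range_one_sub_inv (fun y hy => by simpa only [one_mul] using h₁ y hy) j
  rw [count_edgeStats, count_edgeStats]
  simpa using h₂

theorem sum_degree (R : IsRooting T r p h) (W : Finset V) :
    ∑ v ∈ W, T.degree v + innerEdges r p Wᶜ + 1 = Fintype.card V + innerEdges r p W := by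
  have h₁ : ∑ v ∈ W, (Finset.univ.filter fun x => x ≠ r ∧ p x = v).card =
      (Finset.univ.filter fun x => x ≠ r ∧ p x ∈ W).card := by
    rw [Finset.card_eq_sum_card_fiberwise (f := p) (t := W) (fun x hx => by simp_all)]
    refine Finset.sum_congr rfl fun v hv => ?_
    rw [Finset.filter_filter]
    congr 1
    ext x
    simp only [Finset.mem_filter, Finset.mem_univ, true_and]
    constructor
    · rintro ⟨hx, rfl⟩
      exact ⟨⟨hx, hv⟩, rfl⟩
    · rintro ⟨⟨hx, -⟩, hp⟩
      exact ⟨hx, hp⟩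
  have h₂ : ∑ v ∈ W, (if v = r then 0 else 1) =
      (Finset.univ.filter fun x => x ≠ r ∧ x ∈ W).card := by
    have h : (Finset.univ.filter fun x => x ≠ r ∧ x ∈ W) = W.filter fun x => x ≠ r := by
      ext x
      simp [and_comm]
    rw [h, Finset.card_filter]
    exact Finset.sum_congr rfl fun v _ => by by_cases hvr : v = r <;> simp [hvr]
  have h₃ : (Finset.univ.filter fun x => x ≠ r ∧ p x ∈ W).card +
      (Finset.univ.filter fun x => x ≠ r ∧ x ∈ W).card + innerEdges r p Wᶜ =
      (Finset.univ.filter fun x => x ≠ r).card + innerEdges r p W := by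
    simp only [innerEdges, Finset.card_filter, ← Finset.sum_add_distrib]
    refine Finset.sum_congr rfl fun x _ => ?_
    by_cases hxr : x = r <;> by_cases hx : x ∈ W <;> by_cases hpx : p x ∈ W <;>
      simp [hxr, hx, hpx]
  have h₄ : (Finset.univ.filter fun x => x ≠ r).card + 1 = Fintype.card V := by
    rw [Finset.filter_ne', Finset.card_erase_add_one (Finset.mem_univ r), Finset.card_univ]
  simp only [R.degree_eq, Finset.sum_add_distrib]
  omega

theorem parent_closed_iff {W : Finset V} (R : IsRooting T r p h) (hrW : r ∈ W) :
    (∀ x ∈ W, p x ∈ W) ↔ innerEdges r p W + 1 = W.card := by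
  have he : innerEdges r p W = ((W.erase r).filter fun x => p x ∈ W).card := by
    rw [innerEdges]
    congr 1
    ext x
    simp [and_assoc]
  rw [he, ← Finset.card_erase_add_one hrW, Nat.add_right_cancel_iff, Finset.card_filter_eq_iff]
  constructor
  · exact fun hW x hx => hW x (Finset.mem_of_mem_erase hx)
  · intro hW x hx
    by_cases hxr : x = r
    · rwa [hxr, R.parent_root]
    · exact hW x (Finset.mem_erase.2 ⟨hxr, hx⟩)

theorem mem_prunedSets_iff (R : IsRooting T r p h) (hr : 3 ≤ T.degree r) (W : Finset V) :
    W ∈ prunedSets T p ↔ innerEdges r p W + 1 = W.card ∧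
      ∑ v ∈ W, T.degree v = 2 * W.card + ∑ v, (T.degree v - 2) := by
  have hsum : ∑ v ∈ W, T.degree v + (∑ v ∈ W, (2 - T.degree v) + ∑ v ∈ Wᶜ, (T.degree v - 2)) =
      2 * W.card + ∑ v, (T.degree v - 2) := by
    rw [← Finset.sum_add_sum_compl W, ← add_assoc, ← add_assoc, ← Finset.sum_add_distrib, mul_comm,
      ← smul_eq_mul, ← Finset.sum_const, ← Finset.sum_add_distrib]
    congr 1
    exact Finset.sum_congr rfl fun v _ => by omega
  have hiff : ∑ v ∈ W, T.degree v = 2 * W.card + ∑ v, (T.degree v - 2) ↔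
      (∀ v ∈ W, T.degree v ≠ 1) ∧ ∀ v, 3 ≤ T.degree v → v ∈ W := by
    rw [← hsum, left_eq_add, Nat.add_eq_zero_iff, Finset.sum_eq_zero_iff, Finset.sum_eq_zero_iff]
    refine and_congr (forall₂_congr fun v _ => ?_) (forall_congr' fun v => ?_)
    · have := R.degree_pos hr v
      omega
    · rw [Finset.mem_compl, ← not_imp_not, not_not]
      exact imp_congr (by omega) Iff.rfl
  rw [hiff, prunedSets, Finset.mem_filter]
  constructor
  · rintro ⟨-, h₁, h₂, h₃⟩
    exact ⟨(R.parent_closed_iff (h₂ r hr)).1 h₁, h₃, h₂⟩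
  · rintro ⟨h₁, h₃, h₂⟩
    exact ⟨Finset.mem_univ _, (R.parent_closed_iff (h₂ r hr)).2 h₁, h₂, h₃⟩

theorem sum_degree_le (W : Finset V) :
    ∑ v ∈ W, T.degree v ≤ 2 * W.card + ∑ v, (T.degree v - 2) := by
  calc ∑ v ∈ W, T.degree v ≤ ∑ v ∈ W, (2 + (T.degree v - 2)) :=
        Finset.sum_le_sum fun v _ => by omega
    _ = 2 * W.card + ∑ v ∈ W, (T.degree v - 2) := by
        rw [Finset.sum_add_distrib, Finset.sum_const, smul_eq_mul, mul_comm]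
    _ ≤ _ := Nat.add_le_add_left (Finset.sum_le_sum_of_subset (Finset.subset_univ W)) _

theorem prunedSets_nonempty (R : IsRooting T r p h) (hr : 3 ≤ T.degree r) :
    (prunedSets T p).Nonempty := by
  refine ⟨Finset.univ.filter fun v => T.degree v ≠ 1, ?_⟩
  simp only [prunedSets, Finset.mem_filter, Finset.mem_univ, true_and]
  refine ⟨fun x hx hp => ?_, fun v hv => by omega, fun v hv => hv⟩
  by_cases hxr : x = r
  · rw [hxr, R.parent_root] at hp
    omega
  · exact R.parent_ne_leaf hr hp hxr rfl

theorem exists_mem_prunedSets_iff (R : IsRooting T r p h) (hr : 3 ≤ T.degree r) :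
    ∃ m, (∀ W, innerEdges r p W + 1 = W.card → m ≤ innerEdges r p W + innerEdges r p Wᶜ) ∧
      ∀ W, W ∈ prunedSets T p ↔ innerEdges r p W + 1 = W.card ∧
        innerEdges r p W + innerEdges r p Wᶜ = m := by
  obtain ⟨U, hU⟩ := R.prunedSets_nonempty hr
  rw [R.mem_prunedSets_iff hr] at hU
  have hUd := R.sum_degree U
  refine ⟨innerEdges r p U + innerEdges r p Uᶜ, fun W hW => ?_, fun W => ?_⟩
  · have h₁ := R.sum_degree W
    have h₂ := sum_degree_le (T := T) W
    omega
  · rw [R.mem_prunedSets_iff hr]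
    have h₁ := R.sum_degree W
    omega

end IsRooting

theorem sum_prunedSets_eq {V V' : Type*} [Fintype V] [Fintype V'] {T : SimpleGraph V}
    {T' : SimpleGraph V'} {r : V} {p : V → V} {h : V → ℕ} {r' : V'} {p' : V' → V'} {h' : V' → ℕ}
    (R : IsRooting T r p h) (R' : IsRooting T' r' p' h') (hr : 3 ≤ T.degree r)
    (hr' : 3 ≤ T'.degree r') (hcsf : csf T = csf T') {K : Type*} [CommSemiring K] (q : K) :
    ∑ W ∈ prunedSets T p, q ^ Wᶜ.card = ∑ W ∈ prunedSets T' p', q ^ Wᶜ.card := by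
  have hmap := R.map_edgeStats_eq R' hcsf
  obtain ⟨m, hm, hmem⟩ := R.exists_mem_prunedSets_iff hr
  obtain ⟨m', hm', hmem'⟩ := R'.exists_mem_prunedSets_iff hr'
  have hmm : m = m' := by
    apply le_antisymm
    · obtain ⟨W, hW⟩ := R'.prunedSets_nonempty hr'
      have hW' : edgeStats r' p' W ∈ (Finset.univ : Finset (Finset V)).val.map (edgeStats r p) := by
        rw [hmap]
        exact Multiset.mem_map_of_mem _ (Finset.mem_univ W)
      obtain ⟨U, -, hU⟩ := Multiset.mem_map.1 hW'
      simp only [edgeStats, Prod.mk.injEq] at hU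
      have h₁ := (hmem' W).1 hW
      have h₂ := hm U
      omega
    · obtain ⟨W, hW⟩ := R.prunedSets_nonempty hr
      have hW' : edgeStats r p W ∈
          (Finset.univ : Finset (Finset V')).val.map (edgeStats r' p') := by
        rw [← hmap]
        exact Multiset.mem_map_of_mem _ (Finset.mem_univ W)
      obtain ⟨U, -, hU⟩ := Multiset.mem_map.1 hW'
      simp only [edgeStats, Prod.mk.injEq] at hU
      have h₁ := (hmem W).1 hW
      have h₂ := hm' U
      omega
  subst hmm
  have hF := congrArg (fun s => (s.map fun t : ℕ × ℕ × ℕ =>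
    if t.2.1 + 1 = t.1 ∧ t.2.1 + t.2.2 = m then q ^ (Fintype.card V - t.1) else 0).sum) hmap
  simp only [Multiset.map_map, Function.comp_def, edgeStats, ← hmem, ← hmem'] at hF
  have hF' : ∑ W, (if W ∈ prunedSets T p then q ^ (Fintype.card V - W.card) else 0) =
    ∑ W, if W ∈ prunedSets T' p' then q ^ (Fintype.card V - W.card) else 0 := hF
  simpa only [Finset.sum_ite_mem, Finset.univ_inter, Finset.card_compl,
    card_eq_of_csf_eq hcsf] using hF'

theorem stmt4 {V V' : Type*} [Fintype V] [Fintype V']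
    (T : SimpleGraph V) (T' : SimpleGraph V') (hT : T.IsTree) (hT' : T'.IsTree)
    (hdeg : ∃ v : V, 3 ≤ T.degree v) (hdeg' : ∃ v : V', 3 ≤ T'.degree v)
    (A : Finset V) (A' : Finset V') (hA : IsTrunk T A) (hA' : IsTrunk T' A')
    (h : csf T = csf T') :
    A.card = A'.card ∧ twigLengths T = twigLengths T' := by
  obtain ⟨r, hr⟩ := hdeg
  obtain ⟨r', hr'⟩ := hdeg'
  obtain ⟨p, d, R⟩ := exists_isRooting hT r
  obtain ⟨p', d', R'⟩ := exists_isRooting hT' r'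
  have hchain : (leaves T).val.map (chainLength T p) = (leaves T').val.map (chainLength T' p') := by
    refine Multiset.eq_of_prod_geom_eq ?_ ?_ ?_
    · intro a ha
      obtain ⟨l, hl, rfl⟩ := Multiset.mem_map.1 ha
      exact R.chainLength_pos hr (Finset.mem_filter.1 hl).2
    · intro a ha
      obtain ⟨l, hl, rfl⟩ := Multiset.mem_map.1 ha
      exact R'.chainLength_pos hr' (Finset.mem_filter.1 hl).2
    · have hs := sum_prunedSets_eq R R' hr hr' h (Polynomial.X : Polynomial ℂ)
      rw [R.sum_prunedSets hr, R'.sum_prunedSets hr'] at hs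
      rw [Multiset.map_map, Multiset.map_map]
      exact hs
  have htwig : twigLengths T = (leaves T).val.map (chainLength T p) :=
    Multiset.map_congr rfl fun l hl => R.twigLen_eq hr (Finset.mem_filter.1 hl).2
  have htwig' : twigLengths T' = (leaves T').val.map (chainLength T' p') :=
    Multiset.map_congr rfl fun l hl => R'.twigLen_eq hr' (Finset.mem_filter.1 hl).2
  refine ⟨?_, by rw [htwig, htwig', hchain]⟩
  have h₁ := R.trunk_card hr hA
  have h₂ := R'.trunk_card hr' hA'
  have h₃ : ∑ l ∈ leaves T, chainLength T p l = ∑ l ∈ leaves T', chainLength T' p' l :=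
    congrArg Multiset.sum hchain
  have h₄ := card_eq_of_csf_eq h
  omega
end
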